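/- Let ξ_1,…,ξ_n : ℤ^r → ℤ be nonzero linear forms such that S = {x ∈ ℤ^r : ξ_i(x) ≥ 0 for all i} is positive and gp(S) = ℤ^r; let K be a field and R = K[S]. For every m ∈ ℤ_+ there exist, up to R-module isomorphism, only finitely many ξ-convex ideals I(a;ξ) with μ(I(a;ξ)) ≤ m; equivalently, there are only finitely many sets T(a;ξ), a ∈ ℤ^n, up to translation by elements of ℤ^r, that can be covered by at most m translates x + S with x ∈ T(a;ξ). -/

import Mathlib

set_option synthInstance.maxHeartbeats 1000000
set_option maxHeartbeats 1000000

open scoped BigOperators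

noncomputable section

/-- Pairing of an integral linear form (given by its coefficient vector `f`) with `x`. -/
def lin {r : ℕ} (f x : Fin r → ℤ) : ℤ := ∑ k, f k * x k

lemma lin_zero {r : ℕ} (f : Fin r → ℤ) : lin f 0 = 0 := by simp [lin]

lemma lin_add {r : ℕ} (f x y : Fin r → ℤ) : lin f (x + y) = lin f x + lin f y := by
  simp [lin, mul_add, Finset.sum_add_distrib]

/-- A family of integral linear forms, bundled as an additive homomorphism `ℤ^r → ℤ^s`. -/
def formsHom {r s : ℕ} (σ : Fin s → Fin r → ℤ) : (Fin r → ℤ) →+ (Fin s → ℤ) where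
  toFun x i := lin (σ i) x
  map_zero' := by funext i; simp [lin_zero]
  map_add' x y := by funext i; simp [lin_add]

/-- The subgroup `σ(ℤ^r) ⊆ ℤ^s`. -/
def formsRange {r s : ℕ} (σ : Fin s → Fin r → ℤ) : AddSubgroup (Fin s → ℤ) :=
  (formsHom σ).range

/-- The divisor class group `Cl(R) = ℤ^s / σ(ℤ^r)`. -/
abbrev classGroup {r s : ℕ} (σ : Fin s → Fin r → ℤ) : Type :=
  (Fin s → ℤ) ⧸ formsRange σ

/-- The set of solutions of the inhomogeneous system of inequalities `σ_i(x) ≥ a_i`. -/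
def Tset {r s : ℕ} (σ : Fin s → Fin r → ℤ) (a : Fin s → ℤ) : Set (Fin r → ℤ) :=
  {x | ∀ i, a i ≤ lin (σ i) x}

/-- The normal semigroup of solutions of the homogeneous system `ξ_i(x) ≥ 0`. -/
def ineqSemigroup {r n : ℕ} (ξ : Fin n → Fin r → ℤ) : AddSubmonoid (Fin r → ℤ) where
  carrier := {x | ∀ i, 0 ≤ lin (ξ i) x}
  zero_mem' := fun i => by simp [lin_zero]
  add_mem' := fun hx hy i => by rw [lin_add]; exact add_nonneg (hx i) (hy i)

lemma lin_sub {r : ℕ} (f x y : Fin r → ℤ) : lin f (x - y) = lin f x - lin f y := by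
  simp [lin, mul_sub, Finset.sum_sub_distrib]

lemma lin_smul {r : ℕ} (f : Fin r → ℤ) (c : ℤ) (x : Fin r → ℤ) :
    lin f (c • x) = c * lin f x := by
  simp [lin, Finset.mul_sum, mul_left_comm]

lemma lin_single {r : ℕ} (f : Fin r → ℤ) (k : Fin r) : lin f (Pi.single k 1) = f k := by
  simp [lin, Pi.single_apply]

lemma lin_sum {r : ℕ} {ι : Type*} (s : Finset ι) (f : Fin r → ℤ) (x : ι → Fin r → ℤ) :
    lin f (∑ i ∈ s, x i) = ∑ i ∈ s, lin f (x i) := by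
  simp only [lin, Finset.sum_apply, Finset.mul_sum]
  exact Finset.sum_comm

/-- If `S` generates `ℤ^r`, some element of `S` is strictly positive under every form. -/
lemma exists_forall_one_le_lin {r n : ℕ} (ξ : Fin n → Fin r → ℤ) (hξ : ∀ i, ξ i ≠ 0)
    (hgp : ∀ x : Fin r → ℤ, ∃ a ∈ ineqSemigroup ξ, ∃ b ∈ ineqSemigroup ξ, x = a - b) :
    ∃ u : Fin r → ℤ, ∀ i, 1 ≤ lin (ξ i) u := by
  have key : ∀ i, ∃ s ∈ ineqSemigroup ξ, 1 ≤ lin (ξ i) s := by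
    intro i
    obtain ⟨k, hk⟩ := Function.ne_iff.mp (hξ i)
    obtain ⟨a, ha, b, hb, hab⟩ := hgp (Pi.single k 1)
    have h1 : ξ i k = lin (ξ i) a - lin (ξ i) b := by
      rw [← lin_sub, ← hab, lin_single]
    have h2 : 0 ≤ lin (ξ i) a := ha i
    have h3 : 0 ≤ lin (ξ i) b := hb i
    have h4 : ξ i k ≠ 0 := hk
    by_cases h : 1 ≤ lin (ξ i) a
    · exact ⟨a, ha, h⟩
    · exact ⟨b, hb, by omega⟩
  choose s hs hs1 using key
  refine ⟨∑ i, s i, fun i => ?_⟩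
  rw [lin_sum]
  exact (hs1 i).trans
    (Finset.single_le_sum (f := fun j => lin (ξ i) (s j)) (fun j _ => hs j i) (Finset.mem_univ i))

/-- Every `T(a;ξ)` is nonempty. -/
lemma Tset_nonempty {r n : ℕ} (ξ : Fin n → Fin r → ℤ) {u : Fin r → ℤ}
    (hu : ∀ i, 1 ≤ lin (ξ i) u) (a : Fin n → ℤ) : (Tset ξ a).Nonempty := by
  refine ⟨(∑ i, |a i|) • u, fun i => ?_⟩
  rw [lin_smul]
  have h1 : |a i| ≤ ∑ i, |a i| :=
    Finset.single_le_sum (f := fun j => |a j|) (fun j _ => abs_nonneg _) (Finset.mem_univ i)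
  nlinarith [hu i, le_abs_self (a i), abs_nonneg (a i)]

/-- Points of a segment can be rounded to lattice points so that all the forms increase, but
only by a bounded amount. -/
lemma exists_rounding {r n : ℕ} (ξ : Fin n → Fin r → ℤ) {u : Fin r → ℤ}
    (hu : ∀ i, 1 ≤ lin (ξ i) u) :
    ∃ C : ℤ, 0 ≤ C ∧ ∀ (x y : Fin r → ℤ) (p D : ℤ), 0 < D → ∃ z : Fin r → ℤ, ∀ i,
      (D - p) * lin (ξ i) x + p * lin (ξ i) y ≤ D * lin (ξ i) z ∧
      D * lin (ξ i) z ≤ (D - p) * lin (ξ i) x + p * lin (ξ i) y + D * C := by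
  set M : ℤ := ∑ i, ∑ k, |ξ i k| with hM
  have hM0 : 0 ≤ M := Finset.sum_nonneg fun i _ => Finset.sum_nonneg fun k _ => abs_nonneg _
  have hMi : ∀ i, ∑ k, |ξ i k| ≤ M := fun i =>
    Finset.single_le_sum (f := fun i => ∑ k, |ξ i k|)
      (fun i _ => Finset.sum_nonneg fun k _ => abs_nonneg _) (Finset.mem_univ i)
  have hU : ∀ i, lin (ξ i) u ≤ ∑ i, lin (ξ i) u := fun i =>
    Finset.single_le_sum (f := fun i => lin (ξ i) u)
      (fun i _ => by linarith [hu i]) (Finset.mem_univ i)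
  have hU0 : 0 ≤ ∑ i, lin (ξ i) u := Finset.sum_nonneg fun i _ => by linarith [hu i]
  refine ⟨M + M * ∑ i, lin (ξ i) u, by positivity, fun x y p D hD => ?_⟩
  let d : Fin r → ℤ := fun k => p * (y k - x k) / D
  let e : Fin r → ℤ := fun k => p * (y k - x k) % D
  refine ⟨x + d + M • u, fun i => ?_⟩
  have hde : D • d = p • (y - x) - e := by
    funext k
    have := Int.mul_ediv_add_emod (p * (y k - x k)) D
    simp only [Pi.smul_apply, Pi.sub_apply, smul_eq_mul, d, e]
    linarith
  have hd : D * lin (ξ i) d = p * (lin (ξ i) y - lin (ξ i) x) - lin (ξ i) e := by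
    rw [← lin_smul, hde, lin_sub, lin_smul, lin_sub]
  have he : |lin (ξ i) e| ≤ D * M := by
    calc |lin (ξ i) e| ≤ ∑ k, |ξ i k * e k| := Finset.abs_sum_le_sum_abs _ _
      _ ≤ ∑ k, D * |ξ i k| := by
        refine Finset.sum_le_sum fun k _ => ?_
        have h0 : 0 ≤ e k := Int.emod_nonneg _ hD.ne'
        have h1 : e k ≤ D := (Int.emod_lt_of_pos _ hD).le
        rw [abs_mul, abs_of_nonneg h0, mul_comm]
        exact mul_le_mul_of_nonneg_right h1 (abs_nonneg _)
      _ ≤ D * M := by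
        rw [← Finset.mul_sum]
        exact mul_le_mul_of_nonneg_left (hMi i) hD.le
  obtain ⟨he1, he2⟩ := abs_le.mp he
  rw [lin_add, lin_add, lin_smul]
  have h1 : D * M ≤ D * (M * lin (ξ i) u) :=
    mul_le_mul_of_nonneg_left (by nlinarith [hu i]) hD.le
  have h2 : D * (M * lin (ξ i) u) ≤ D * (M * ∑ i, lin (ξ i) u) :=
    mul_le_mul_of_nonneg_left (mul_le_mul_of_nonneg_left (hU i) hM0) hD.le
  constructor <;> nlinarith

/-- A supporting line of a finite planar point set, with nonnegative slope parameter `θ`,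
that touches the set on both sides of the level `g = q`. -/
lemma exists_tied_minimizers {ι : Type*} [Fintype ι] (f g : ι → ℤ) (q : ℤ) (A B : ι)
    (hA : ∀ j, f A ≤ f j) (hqA : q < g A) (hqB : g B ≤ q) :
    ∃ (θ : ℝ) (x y : ι), 0 ≤ θ ∧ g x ≤ q ∧ q < g y ∧
      (∀ j, (f x : ℝ) + θ * g x ≤ f j + θ * g j) ∧
      (∀ j, (f y : ℝ) + θ * g y ≤ f j + θ * g j) := by
  classical
  let lo : Finset ι := Finset.univ.filter fun j => g j ≤ q
  let hi : Finset ι := Finset.univ.filter fun j => q < g j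
  have hlo : lo.Nonempty := ⟨B, by simp [lo, hqB]⟩
  have hhi : hi.Nonempty := ⟨A, by simp [hi, hqA]⟩
  let h : ℝ → ι → ℝ := fun θ j => f j + θ * g j
  let F : ℝ → ℝ := fun θ => lo.inf' hlo (h θ)
  let H : ℝ → ℝ := fun θ => hi.inf' hhi (h θ)
  have hcont : ∀ j, Continuous fun θ => h θ j := fun j => by fun_prop
  have hF : Continuous F := Continuous.finset_inf'_apply hlo fun j _ => hcont j
  have hH : Continuous H := Continuous.finset_inf'_apply hhi fun j _ => hcont j
  have hΘ : (0 : ℝ) ≤ f B - f A := by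
    have := hA B
    rw [sub_nonneg]; exact_mod_cast this
  have h0 : H 0 ≤ F 0 := by
    refine Finset.le_inf' _ _ fun j _ => (Finset.inf'_le _ (by simp [hi, hqA] : A ∈ hi)).trans ?_
    simpa [h] using hA j
  have h1 : F (f B - f A) ≤ H (f B - f A) := by
    refine Finset.le_inf' _ _ fun j hj => (Finset.inf'_le _ (by simp [lo, hqB] : B ∈ lo)).trans ?_
    have hj' : q < g j := by simpa [hi] using hj
    have e1 : (g B : ℝ) + 1 ≤ g j := by exact_mod_cast (by omega : g B + 1 ≤ g j)
    have e2 : (f A : ℝ) ≤ f j := by exact_mod_cast hA j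
    simp only [h]
    nlinarith
  obtain ⟨θ, hθ, hθ'⟩ := intermediate_value_Icc' hΘ (hF.sub hH).continuousOn
    (show (0 : ℝ) ∈ _ from ⟨sub_nonpos.mpr h1, sub_nonneg.mpr h0⟩)
  have heq : F θ = H θ := by simpa [sub_eq_zero] using hθ'
  obtain ⟨x, hx, hFx⟩ := Finset.exists_mem_eq_inf' hlo (h θ)
  obtain ⟨y, hy, hHy⟩ := Finset.exists_mem_eq_inf' hhi (h θ)
  have hmin : ∀ j, F θ ≤ h θ j := by
    intro j
    by_cases hj : g j ≤ q
    · exact Finset.inf'_le _ (by simp [lo, hj])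
    · rw [heq]
      exact Finset.inf'_le _ (by simp [hi]; omega)
  refine ⟨θ, x, y, hθ.1, by simpa [lo] using hx, by simpa [hi] using hy, fun j => ?_, fun j => ?_⟩
  · exact hFx.symm.trans_le (hmin j)
  · exact (hHy.symm.trans heq.symm).trans_le (hmin j)

/-- Every level `q` of the form `ξ i` between its value at a generator and its value at a generator
minimizing `∑ k, ξ k` is within bounded distance of the value of `ξ i` at some generator. -/
lemma exists_generator_near_level {r n : ℕ} (ξ : Fin n → Fin r → ℤ) {C : ℤ} (hC : 0 ≤ C)
    (hround : ∀ (x y : Fin r → ℤ) (p D : ℤ), 0 < D → ∃ z : Fin r → ℤ, ∀ i,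
      (D - p) * lin (ξ i) x + p * lin (ξ i) y ≤ D * lin (ξ i) z ∧
      D * lin (ξ i) z ≤ (D - p) * lin (ξ i) x + p * lin (ξ i) y + D * C)
    {a : Fin n → ℤ} {g : ℕ} {x : Fin g → Fin r → ℤ} (hx : ∀ j, x j ∈ Tset ξ a)
    (hcover : ∀ z ∈ Tset ξ a, ∃ j, z - x j ∈ ineqSemigroup ξ) {A : Fin g}
    (hA : ∀ j, ∑ k, lin (ξ k) (x A) ≤ ∑ k, lin (ξ k) (x j)) {i : Fin n} {B : Fin g} {q : ℤ}
    (hqA : q < lin (ξ i) (x A)) (hqB : lin (ξ i) (x B) ≤ q) :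
    ∃ j, |lin (ξ i) (x j) - q| ≤ n * C := by
  obtain ⟨θ, b, t, hθ, hb, ht, hbmin, htmin⟩ := exists_tied_minimizers
    (fun j => ∑ k, lin (ξ k) (x j)) (fun j => lin (ξ i) (x j)) q A B hA hqA hqB
  obtain ⟨D, hDdef⟩ : ∃ D, D = lin (ξ i) (x t) - lin (ξ i) (x b) := ⟨_, rfl⟩
  obtain ⟨p, hpdef⟩ : ∃ p, p = q - lin (ξ i) (x b) := ⟨_, rfl⟩
  have hD : 0 < D := by omega
  have hp : 0 ≤ p := by omega
  have hpD : p ≤ D := by omega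
  obtain ⟨z, hz⟩ := hround (x b) (x t) p D hD
  have hzT : z ∈ Tset ξ a := by
    intro k
    have h1 := mul_le_mul_of_nonneg_left (hx b k) (sub_nonneg.mpr hpD)
    have h2 := mul_le_mul_of_nonneg_left (hx t k) hp
    have h3 := (hz k).1
    exact le_of_mul_le_mul_left (by linarith) hD
  obtain ⟨j, hj⟩ := hcover z hzT
  have hS : ∀ k, lin (ξ k) (x j) ≤ lin (ξ k) z := fun k => by
    have : 0 ≤ lin (ξ k) (z - x j) := hj k
    rwa [lin_sub, sub_nonneg] at this
  have hqz : q ≤ lin (ξ i) z := by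
    refine le_of_mul_le_mul_left ((le_of_eq ?_).trans (hz i).1) hD
    rw [hDdef, hpdef]; ring
  have hzq : lin (ξ i) z ≤ q + C := by
    refine le_of_mul_le_mul_left ((hz i).2.trans (le_of_eq ?_)) hD
    rw [hDdef, hpdef]; ring
  have hCn : C ≤ n * C := by
    have : (1 : ℤ) ≤ n := by exact_mod_cast (Fin.pos i)
    nlinarith
  have hsum : D * ∑ k, lin (ξ k) z ≤
      (D - p) * ∑ k, lin (ξ k) (x b) + p * ∑ k, lin (ξ k) (x t) + D * (n * C) := by
    have := Finset.sum_le_sum fun k (_ : k ∈ Finset.univ) => (hz k).2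
    simp only [Finset.sum_add_distrib, ← Finset.mul_sum, Finset.sum_const, Finset.card_univ,
      Fintype.card_fin, nsmul_eq_mul] at this
    linarith
  have hdiff : lin (ξ i) z - lin (ξ i) (x j) ≤
      ∑ k, lin (ξ k) z - ∑ k, lin (ξ k) (x j) := by
    rw [← Finset.sum_sub_distrib]
    exact Finset.single_le_sum (f := fun k => lin (ξ k) z - lin (ξ k) (x j))
      (fun k _ => sub_nonneg.mpr (hS k)) (Finset.mem_univ i)
  have hbound : lin (ξ i) z - lin (ξ i) (x j) ≤ n * C := by
    by_contra! hcon
    have hcon' := hcon.trans_le hdiff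
    have hb' := hbmin j
    have ht' := htmin j
    have hDi := (hz i).2
    have hDC := mul_le_mul_of_nonneg_left hCn hD.le
    generalize ∑ k, lin (ξ k) z = lz at *
    generalize ∑ k, lin (ξ k) (x j) = lj at *
    generalize ∑ k, lin (ξ k) (x b) = lb at *
    generalize ∑ k, lin (ξ k) (x t) = lt at *
    generalize lin (ξ i) z = cz at *
    generalize lin (ξ i) (x j) = cj at *
    generalize lin (ξ i) (x b) = cb at *
    generalize lin (ξ i) (x t) = ct at *
    generalize (n : ℤ) * C = E at *
    have hDR : (0 : ℝ) < D := by exact_mod_cast hD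
    have hpR : (0 : ℝ) ≤ p := by exact_mod_cast hp
    have hpDR : (0 : ℝ) ≤ D - p := by rw [sub_nonneg]; exact_mod_cast hpD
    have e1 : (D : ℝ) * lz ≤ (D - p) * lb + p * lt + D * E := by exact_mod_cast hsum
    have e2 : (D : ℝ) * cz ≤ (D - p) * cb + p * ct + D * E := by
      exact_mod_cast hDi.trans (by linarith)
    have e3 : (E : ℝ) < lz - lj := by exact_mod_cast hcon'
    have e4 : (E : ℝ) < cz - cj := by exact_mod_cast hcon
    have e5 := mul_le_mul_of_nonneg_left hb' hpDR
    have e6 := mul_le_mul_of_nonneg_left ht' hpR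
    have e7 := mul_le_mul_of_nonneg_left e2 hθ
    have e8 := mul_lt_mul_of_pos_left e3 hDR
    have e9 := mul_le_mul_of_nonneg_left (mul_le_mul_of_nonneg_left e4.le hDR.le) hθ
    nlinarith
  have := hS i
  refine ⟨j, abs_le.mpr ?_⟩
  constructor <;> linarith


/-- Theorem: finiteness for `ξ`-convex ideals.
Let `S = {x ∈ ℤ^r : ξ_i(x) ≥ 0}` be positive with `gp(S) = ℤ^r`.  For every `m` there are,
up to translation by elements of `ℤ^r` (equivalently, up to `R`-module isomorphism of the
corresponding `ξ`-convex ideals), only finitely many sets `T(a;ξ)` that can be covered by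
at most `m` translates `x + S` with `x ∈ T(a;ξ)`. -/
theorem finitely_many_xi_convex_ideals_with_few_generators
    {r n : ℕ}
    (ξ : Fin n → Fin r → ℤ)
    (hξ : ∀ i, ξ i ≠ 0)
    (hpos : ∀ x ∈ ineqSemigroup ξ, -x ∈ ineqSemigroup ξ → x = 0)
    (hgp : ∀ x : Fin r → ℤ, ∃ a ∈ ineqSemigroup ξ, ∃ b ∈ ineqSemigroup ξ, x = a - b)
    (m : ℕ) :
    ∃ (N : ℕ) (b : Fin N → Fin n → ℤ),
      ∀ a : Fin n → ℤ,
        (∃ (g : ℕ) (x : Fin g → Fin r → ℤ), g ≤ m ∧ (∀ i, x i ∈ Tset ξ a) ∧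
          Tset ξ a = ⋃ i, (fun y => x i + y) '' (ineqSemigroup ξ : Set (Fin r → ℤ))) →
        ∃ (i : Fin N) (y : Fin r → ℤ), Tset ξ a = (fun x => y + x) '' Tset ξ (b i) := by
  obtain ⟨u, hu⟩ := exists_forall_one_le_lin ξ hξ hgp
  obtain ⟨C, hC, hround⟩ := exists_rounding ξ hu
  have hnC : (0 : ℤ) ≤ n * C := by positivity
  let L : ℤ := m * (2 * (n * C) + 1)
  let e := Fintype.equivFin (Fin n → Set.Icc (-L) 0)
  refine ⟨_, fun k i => (e.symm k i : ℤ), ?_⟩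
  rintro a ⟨g, x, hgm, hx, hT⟩
  have hcover : ∀ z ∈ Tset ξ a, ∃ j, z - x j ∈ ineqSemigroup ξ := by
    intro z hz
    rw [hT, Set.mem_iUnion] at hz
    obtain ⟨j, s, hs, rfl⟩ := hz
    exact ⟨j, by simpa using hs⟩
  obtain ⟨z₀, hz₀⟩ := Tset_nonempty ξ hu a
  obtain ⟨j₀, -⟩ := hcover z₀ hz₀
  have : Nonempty (Fin g) := ⟨j₀⟩
  obtain ⟨A, hA⟩ := Finite.exists_min fun j => ∑ k, lin (ξ k) (x j)
  choose B hB using fun i => Finite.exists_min fun j => lin (ξ i) (x j)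
  have hlevel : ∀ i, lin (ξ i) (x A) ≤ lin (ξ i) (x (B i)) + L := by
    intro i
    by_contra! hcon
    have hq : ∀ k : Fin (m + 1), ∃ j,
        |lin (ξ i) (x j) - (lin (ξ i) (x (B i)) + k * (2 * (n * C) + 1))| ≤ n * C := by
      intro k
      have hk : (k : ℤ) ≤ m := by exact_mod_cast Nat.lt_succ_iff.mp k.2
      have hkL : (k : ℤ) * (2 * (n * C) + 1) ≤ L :=
        mul_le_mul_of_nonneg_right hk (by positivity)
      exact exists_generator_near_level ξ hC hround hx hcover hA (B := B i) (by linarith)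
        (le_add_of_nonneg_right (by positivity))
    choose φ hφ using hq
    have hinj : Function.Injective φ := by
      intro k l hkl
      have hk := abs_le.mp (hφ k)
      have hl := abs_le.mp (hφ l)
      rw [hkl] at hk
      by_contra hne
      rcases lt_or_gt_of_ne (fun h => hne (Fin.ext h) : (k : ℕ) ≠ l) with h | h
      · have : (k : ℤ) + 1 ≤ l := by exact_mod_cast h
        nlinarith
      · have : (l : ℤ) + 1 ≤ k := by exact_mod_cast h
        nlinarith
    have := Fintype.card_le_of_injective φ hinj
    simp only [Fintype.card_fin] at this
    omega
  let c : Fin n → Set.Icc (-L) 0 := fun i =>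
    ⟨lin (ξ i) (x (B i)) - lin (ξ i) (x A), by linarith [hlevel i], by linarith [hB i A]⟩
  refine ⟨e c, x A, Set.ext fun z => ⟨fun hz => ⟨z - x A, fun i => ?_, by simp⟩, ?_⟩⟩
  · obtain ⟨j, hj⟩ := hcover z hz
    have h1 : 0 ≤ lin (ξ i) (z - x j) := hj i
    simp only [Equiv.symm_apply_apply, c, lin_sub] at h1 ⊢
    linarith [hB i j]
  · rintro ⟨w, hw, rfl⟩ i
    have h1 := hw i
    have h2 := hx (B i) i
    simp only [Equiv.symm_apply_apply, c] at h1
    rw [lin_add]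
    linarith
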